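/- arXiv:1903.11057 — 3 statements merged into one kernel-verified Lean document; each statement's English description precedes it below -/
import Mathlib

section
/- For all integers n and m: u(n−m)·w(n+m) = u(n)·w(n) − q^(n−m)·u(m)·w(m). -/
/-- A two-sided sequence satisfying a second-order linear recurrence with invertible last
coefficient vanishes identically as soon as it vanishes at `0` and `1`. -/
theorem eq_zero_of_linear_recurrence {K : Type*} [Field K] {p q : K} (hq : q ≠ 0) {f : ℤ → K}
    (hf : ∀ n : ℤ, f (n + 2) = p * f (n + 1) - q * f n) (h0 : f 0 = 0) (h1 : f 1 = 0) (n : ℤ) :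
    f n = 0 := by
  suffices h : f n = 0 ∧ f (n + 1) = 0 from h.1
  induction n with
  | zero => simpa using ⟨h0, h1⟩
  | succ k ih =>
    refine ⟨ih.2, ?_⟩
    rw [add_assoc, one_add_one_eq_two, hf, ih.1, ih.2]
    ring
  | pred k ih =>
    have h := hf (-k - 1)
    rw [show (-k - 1 + 2 : ℤ) = -k + 1 by ring, sub_add_cancel, ih.1, ih.2] at h
    refine ⟨?_, by simpa using ih.1⟩
    simpa [hq] using h

/-- The d'Ocagne identity for a Horadam sequence `w` and its Lucas sequence `u`. -/
theorem horadam_dOcagne {K : Type*} [Field K] {p q : K} (hq : q ≠ 0) {w u : ℤ → K}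
    (hw : ∀ n : ℤ, w (n + 2) = p * w (n + 1) - q * w n)
    (hu0 : u 0 = 0) (hu1 : u 1 = 1)
    (hu : ∀ n : ℤ, u (n + 2) = p * u (n + 1) - q * u n) (k j : ℤ) :
    u (k + 1) * w (k + j) - u k * w (k + j + 1) = q ^ k * w j := by
  have step (k : ℤ) : u (k + 1 + 1) * w (k + 1 + j) - u (k + 1) * w (k + 1 + j + 1) =
      q * (u (k + 1) * w (k + j) - u k * w (k + j + 1)) := by
    rw [show k + 1 + 1 = k + 2 by ring, show k + 1 + j + 1 = k + j + 2 by ring,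
      show k + 1 + j = k + j + 1 by ring, hu, hw]
    ring
  induction k with
  | zero => simp [hu0, hu1]
  | succ k ih => rw [step, ih, zpow_add_one₀ hq]; ring
  | pred k ih =>
    have h := step (-k - 1)
    rw [sub_add_cancel, ih] at h
    apply mul_left_cancel₀ hq
    rw [sub_add_cancel, ← h, zpow_sub_one₀ hq]
    field_simp

/-- The Vajda identity for a Horadam sequence `w` and its Lucas sequence `u`. -/
theorem horadam_vajda {K : Type*} [Field K] {p q : K} (hq : q ≠ 0) {w u : ℤ → K}
    (hw : ∀ n : ℤ, w (n + 2) = p * w (n + 1) - q * w n)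
    (hu0 : u 0 = 0) (hu1 : u 1 = 1)
    (hu : ∀ n : ℤ, u (n + 2) = p * u (n + 1) - q * u n) (k i j : ℤ) :
    u (k + i) * w (k + j) - u k * w (k + j + i) = q ^ k * u i * w j := by
  rw [← sub_eq_zero]
  refine eq_zero_of_linear_recurrence (p := p) hq
    (f := fun i ↦ u (k + i) * w (k + j) - u k * w (k + j + i) - q ^ k * u i * w j)
    (fun i ↦ ?_) (by simp [hu0]) ?_ i
  · simp only [← add_assoc, hu, hw]
    ring
  · simp [hu1, horadam_dOcagne hq hw hu0 hu1 hu]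

theorem stmt_7 (p q a b : ℂ) (hq : q ≠ 0) (w u : ℤ → ℂ)
    (hw0 : w 0 = a) (hw1 : w 1 = b)
    (hw : ∀ n : ℤ, w n = p * w (n - 1) - q * w (n - 2))
    (hu0 : u 0 = 0) (hu1 : u 1 = 1)
    (hu : ∀ n : ℤ, u n = p * u (n - 1) - q * u (n - 2))
    (n m : ℤ) :
    u (n - m) * w (n + m) = u n * w n - q ^ (n - m) * u m * w m := by
  have shift {f : ℤ → ℂ} (hf : ∀ n : ℤ, f n = p * f (n - 1) - q * f (n - 2)) (n : ℤ) :
      f (n + 2) = p * f (n + 1) - q * f n := by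
    rw [hf (n + 2), add_sub_cancel_right, show n + 2 - 1 = n + 1 by ring]
  have h := horadam_vajda hq (shift hw) hu0 hu1 (shift hu) (n - m) m m
  rw [sub_add_cancel] at h
  rw [← h]
  ring
end

section
/- For all integers n and m: w(n+m)² − q^(2m)·w(n−m)² = v(m)·w(n)·(v(n)·w(m) − a·q^m·v(n−m)). -/
/-- A two-sided second-order recurrent sequence vanishing at `0` and `1` vanishes identically. -/
theorem eq_zero_of_recurrence {p q : ℂ} (hq : q ≠ 0) {f : ℤ → ℂ} (h0 : f 0 = 0) (h1 : f 1 = 0)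
    (hf : ∀ n : ℤ, f n = p * f (n - 1) - q * f (n - 2)) (n : ℤ) : f n = 0 := by
  suffices h : f n = 0 ∧ f (n + 1) = 0 from h.1
  induction n using Int.induction_on with
  | zero => exact ⟨h0, by simpa using h1⟩
  | succ k ih =>
    refine ⟨ih.2, ?_⟩
    rw [hf, show (k : ℤ) + 1 + 1 - 1 = k + 1 by ring, show (k : ℤ) + 1 + 1 - 2 = k by ring,
      ih.1, ih.2]
    ring
  | pred k ih =>
    have h := hf (-(k : ℤ) + 1)
    rw [show -(k : ℤ) + 1 - 1 = -k by ring, show -(k : ℤ) + 1 - 2 = -k - 1 by ring,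
      ih.1, ih.2] at h
    refine ⟨?_, by simpa using ih.1⟩
    have h' : q * f (-(k : ℤ) - 1) = 0 := by linear_combination h
    exact (mul_eq_zero.mp h').resolve_left hq

/-- The addition formula relating a Horadam sequence to the Lucas sequence of the second kind. -/
theorem horadam_add_add_zpow_mul_horadam_sub {p q : ℂ} (hq : q ≠ 0) {w v : ℤ → ℂ}
    (hw : ∀ n : ℤ, w n = p * w (n - 1) - q * w (n - 2))
    (hv0 : v 0 = 2) (hv1 : v 1 = p)
    (hv : ∀ n : ℤ, v n = p * v (n - 1) - q * v (n - 2)) (n m : ℤ) :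
    w (n + m) + q ^ m * w (n - m) = v m * w n := by
  refine sub_eq_zero.mp (eq_zero_of_recurrence (p := p) hq
    (f := fun m => w (n + m) + q ^ m * w (n - m) - v m * w n) ?_ ?_ (fun k => ?_) m)
  · simp only [add_zero, sub_zero, zpow_zero, hv0]
    ring
  · have h := hw (n + 1)
    rw [show n + 1 - 1 = n by ring, show n + 1 - 2 = n - 1 by ring] at h
    simp only [zpow_one, hv1]
    linear_combination h
  · have h₁ := hw (n + k)
    have h₂ := hw (n - (k - 2))
    rw [show n - (k - 2) - 1 = n - (k - 1) by ring, show n - (k - 2) - 2 = n - k by ring] at h₂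
    rw [show n + k - 1 = n + (k - 1) by ring, show n + k - 2 = n + (k - 2) by ring] at h₁
    have e₁ : q ^ (k - 1) = q ^ (k - 2) * q := by
      rw [← zpow_add_one₀ hq]; congr 1; ring
    have e₂ : q ^ k = q ^ (k - 2) * q * q := by
      rw [← e₁, ← zpow_add_one₀ hq]; congr 1; ring
    simp only [e₁, e₂]
    linear_combination h₁ - w n * hv k + q ^ (k - 2) * q * h₂

theorem stmt_9 (p q a b : ℂ) (hq : q ≠ 0) (w v : ℤ → ℂ)
    (hw0 : w 0 = a) (hw1 : w 1 = b)
    (hw : ∀ n : ℤ, w n = p * w (n - 1) - q * w (n - 2))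
    (hv0 : v 0 = 2) (hv1 : v 1 = p)
    (hv : ∀ n : ℤ, v n = p * v (n - 1) - q * v (n - 2))
    (n m : ℤ) :
    w (n + m) ^ 2 - q ^ (2 * m) * w (n - m) ^ 2 = v m * w n * (v n * w m - a * q ^ m * v (n - m)) := by
  have key := horadam_add_add_zpow_mul_horadam_sub hq hw hv0 hv1 hv
  have h₁ := key n m
  have h₂ := key m n
  have h₃ := key 0 (n - m)
  rw [add_comm m n] at h₂
  rw [zero_add, zero_sub, neg_sub, hw0] at h₃
  have e₁ : q ^ (2 * m) = q ^ m * q ^ m := by rw [two_mul, zpow_add₀ hq]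
  have e₂ : q ^ n = q ^ m * q ^ (n - m) := by rw [← zpow_add₀ hq]; congr 1; ring
  have h₄ : w (n + m) - q ^ m * w (n - m) = v n * w m - a * q ^ m * v (n - m) := by
    rw [e₂] at h₂
    linear_combination h₂ - q ^ m * h₃
  rw [e₁, ← h₁, ← h₄]
  ring
end

section
/- For every natural number k and all integers r, s, n, m: ∑_{j=0}^{k} (−1)^j·q^{(r−s)(k−j)}·C(k,j)·u(m−s)^j·u(m−r)^{k−j}·w(n−(m−s)k+(r−s)j) = (−1)^k·u(r−s)^k·w(n), where C(k,j) is the binomial coefficient. -/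
/-- A two-sided second-order linear recurrence with invertible last coefficient is determined
by its values at `0` and `1`. -/
theorem eq_zero_of_second_order_recurrence {p q : ℂ} (hq : q ≠ 0) {f : ℤ → ℂ}
    (hf : ∀ n : ℤ, f n = p * f (n - 1) - q * f (n - 2)) (h0 : f 0 = 0) (h1 : f 1 = 0) (n : ℤ) :
    f n = 0 := by
  suffices h : f n = 0 ∧ f (n + 1) = 0 from h.1
  induction n with
  | zero => simpa using ⟨h0, h1⟩
  | succ i ih =>
    refine ⟨ih.2, ?_⟩
    have h := hf (i + 1 + 1)
    rw [show (i + 1 + 1 - 1 : ℤ) = i + 1 by ring, show (i + 1 + 1 - 2 : ℤ) = i by ring,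
      ih.1, ih.2] at h
    simpa using h
  | pred i ih =>
    have h := hf (-i + 1)
    rw [show (-i + 1 - 1 : ℤ) = -i by ring, show (-i + 1 - 2 : ℤ) = -i - 1 by ring,
      ih.1, ih.2] at h
    refine ⟨?_, by simpa using ih.1⟩
    simpa [hq] using h

/-- The addition formula for Horadam sequences. -/
theorem horadam_add {p q : ℂ} (hq : q ≠ 0) {w u : ℤ → ℂ}
    (hw : ∀ n : ℤ, w n = p * w (n - 1) - q * w (n - 2))
    (hu0 : u 0 = 0) (hu1 : u 1 = 1)
    (hu : ∀ n : ℤ, u n = p * u (n - 1) - q * u (n - 2)) (N A : ℤ) :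
    u A * w (N + 1) - q * u (A - 1) * w N - w (N + A) = 0 := by
  refine eq_zero_of_second_order_recurrence (p := p) hq
    (f := fun A ↦ u A * w (N + 1) - q * u (A - 1) * w N - w (N + A)) (fun A ↦ ?_) ?_ ?_ A
  · have h1 := hu A
    have h2 := hu (A - 1)
    have h3 := hw (N + A)
    simp only [add_sub_assoc, sub_sub] at h1 h2 h3 ⊢
    norm_num at h1 h2 h3 ⊢
    rw [h1, h2, h3]
    ring
  · have h := hu 1
    norm_num [hu0, hu1] at h ⊢
    linear_combination -w N * h
  · simp [hu0, hu1]

theorem horadam_three_term {p q : ℂ} (hq : q ≠ 0) {w u : ℤ → ℂ}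
    (hw : ∀ n : ℤ, w n = p * w (n - 1) - q * w (n - 2))
    (hu0 : u 0 = 0) (hu1 : u 1 = 1)
    (hu : ∀ n : ℤ, u n = p * u (n - 1) - q * u (n - 2)) (N A B : ℤ) :
    u A * w (N + B) - q ^ B * u (A - B) * w N - u B * w (N + A) = 0 := by
  refine eq_zero_of_second_order_recurrence (p := p) hq
    (f := fun B ↦ u A * w (N + B) - q ^ B * u (A - B) * w N - u B * w (N + A))
    (fun B ↦ ?_) ?_ ?_ B
  · have h1 := hu B
    have h2 := hu (A - B + 2)
    have h3 := hw (N + B)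
    rw [show A - B + 2 - 1 = A - (B - 1) by ring, show A - B + 2 - 2 = A - B by ring,
      show A - B + 2 = A - (B - 2) by ring] at h2
    have e1 : q ^ (B - 1) = q ^ (B - 2) * q := by
      rw [← zpow_add_one₀ hq]; congr 1; ring
    have e2 : q ^ B = q ^ (B - 2) * q * q := by
      rw [← e1, ← zpow_add_one₀ hq]; congr 1; ring
    simp only [add_sub_assoc] at h3
    simp only [e1, e2]
    linear_combination u A * h3 - w (N + A) * h1 - q ^ (B - 2) * q * w N * h2
  · simp [hu0]
  · simpa [hu1] using horadam_add hq hw hu0 hu1 hu N A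

/-- Iterating a three-term relation expands binomially. -/
theorem sum_antidiagonal_choose_mul_of_three_term {w : ℤ → ℂ} {x y c : ℂ} {A B : ℤ}
    (h : ∀ n, y * w (n - A) + x * w (n - A + B) = c * w n) (k : ℕ) (n : ℤ) :
    ∑ ij ∈ Finset.HasAntidiagonal.antidiagonal k, (k.choose ij.1 : ℂ) *
      (x ^ ij.1 * y ^ ij.2 * w (n - A * (ij.1 + ij.2) + B * ij.1)) = c ^ k * w n := by
  induction k generalizing n with
  | zero => simp
  | succ k ih =>
    rw [Finset.sum_antidiagonal_choose_succ_mul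
      (fun i j ↦ x ^ i * y ^ j * w (n - A * (i + j) + B * i)), pow_succ, mul_assoc, ← h, mul_add,
      mul_left_comm, mul_left_comm _ x, ← ih, ← ih, Finset.mul_sum, Finset.mul_sum]
    congr 1 <;> refine Finset.sum_congr rfl fun ij hij ↦ ?_
    · rw [show n - A * (ij.1 + (ij.2 + 1 : ℕ)) + B * ij.1
        = n - A - A * (ij.1 + ij.2) + B * ij.1 by push_cast; ring]
      ring
    · rw [show n - A * ((ij.1 + 1 : ℕ) + ij.2) + B * (ij.1 + 1 : ℕ)
        = n - A + B - A * (ij.1 + ij.2) + B * ij.1 by push_cast; ring,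
        ← Nat.choose_symm_of_eq_add (Finset.HasAntidiagonal.mem_antidiagonal.mp hij).symm]
      ring


theorem stmt_13 (p q a b : ℂ) (hq : q ≠ 0) (w u : ℤ → ℂ)
    (hw0 : w 0 = a) (hw1 : w 1 = b)
    (hw : ∀ n : ℤ, w n = p * w (n - 1) - q * w (n - 2))
    (hu0 : u 0 = 0) (hu1 : u 1 = 1)
    (hu : ∀ n : ℤ, u n = p * u (n - 1) - q * u (n - 2))
    (k : ℕ) (r s n m : ℤ) :
    ∑ j ∈ Finset.range (k + 1), (-1) ^ j * q ^ ((r - s) * ((k : ℤ) - j)) * (k.choose j : ℂ) * u (m - s) ^ j * u (m - r) ^ (k - j) * w (n - (m - s) * k + (r - s) * j) = (-1) ^ k * u (r - s) ^ k * w n := by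
  have key (n : ℤ) : q ^ (r - s) * u (m - r) * w (n - (m - s))
      + -u (m - s) * w (n - (m - s) + (r - s)) = -u (r - s) * w n := by
    have h := horadam_three_term hq hw hu0 hu1 hu (n - (m - s)) (m - s) (r - s)
    rw [sub_sub_sub_cancel_right, sub_add_cancel] at h
    linear_combination -h
  rw [← mul_pow, neg_one_mul, ← sum_antidiagonal_choose_mul_of_three_term key,
    Finset.Nat.sum_antidiagonal_eq_sum_range_succ_mk]
  refine Finset.sum_congr rfl fun j hj ↦ ?_
  have hjk : j ≤ k := Nat.lt_succ_iff.mp (Finset.mem_range.mp hj)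
  have hz : q ^ ((r - s) * ((k : ℤ) - j)) = (q ^ (r - s)) ^ (k - j) := by
    rw [zpow_mul, ← Nat.cast_sub hjk, zpow_natCast]
  simp only [hz, Nat.cast_sub hjk, add_sub_cancel, neg_pow (u (m - s)), mul_pow]
  ring
end
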